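/- For a connected graph G, mdim(G) = |V(G)| − ζ(G) if and only if every vertex of G that is not a cut vertex has a maximal neighbor in G. -/

import Mathlib

open SimpleGraph

variable {V : Type*}

/-- Distance from a vertex `w` to an (unordered) edge `e`:
the minimum of the distances to the two endpoints. -/
noncomputable def edgeVertexDist (G : SimpleGraph V) (w : V) (e : Sym2 V) : ℕ :=
  Sym2.lift ⟨fun a b => min (G.dist a w) (G.dist b w), fun a b => by simp [min_comm]⟩ e

/-- Distance from a vertex `w` to a mixed element (vertex or edge). -/
noncomputable def mixedDist (G : SimpleGraph V) (w : V) : V ⊕ G.edgeSet → ℕ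
  | Sum.inl v => G.dist v w
  | Sum.inr e => edgeVertexDist G w e.val

/-- `W` is a mixed resolving set: every two distinct mixed elements are
distinguished by the distance to some vertex of `W`. -/
def IsMixedResolving (G : SimpleGraph V) (W : Set V) : Prop :=
  ∀ x y : V ⊕ G.edgeSet, x ≠ y → ∃ w ∈ W, mixedDist G w x ≠ mixedDist G w y

/-- The mixed metric dimension of a finite graph. -/
noncomputable def mdim [Fintype V] (G : SimpleGraph V) : ℕ :=
  sInf {n | ∃ W : Finset V, W.card = n ∧ IsMixedResolving G ↑W}

/-- `y` is a maximal neighbor of `x`: `y` is a neighbor of `x` adjacent to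
every neighbor of `x` other than `y` itself. -/
def IsMaxNeighbor (G : SimpleGraph V) (x y : V) : Prop :=
  G.Adj x y ∧ ∀ z, G.Adj x z → z ≠ y → G.Adj y z

/-- `v` is a cut vertex of `G`: deleting `v` disconnects the graph. -/
def IsCutVertex (G : SimpleGraph V) (v : V) : Prop :=
  ¬ (G.induce {w | w ≠ v}).Connected

/-- Every walk from `b` to `w` passes through `c`. -/
def Separates (G : SimpleGraph V) (c b w : V) : Prop :=
  ∀ p : G.Walk b w, c ∈ p.support

theorem exists_walk_of_induce {G : SimpleGraph V} {s : Set V} {x y : s}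
    (p : (G.induce s).Walk x y) :
    ∃ q : G.Walk x y, ∀ z ∈ q.support, ∃ h : z ∈ s, (⟨z, h⟩ : s) ∈ p.support := by
  refine ⟨p.map (Embedding.induce s).toHom, fun z hz => ?_⟩
  obtain ⟨u, hu, rfl⟩ := List.mem_map.1 ((Walk.support_map _ p) ▸ hz)
  exact ⟨u.2, hu⟩

theorem not_isCutVertex_iff {G : SimpleGraph V} {w t : V} (ht : t ≠ w) :
    ¬ IsCutVertex G w ↔ ∀ x, x ≠ w → ∃ p : G.Walk x t, w ∉ p.support := by
  rw [IsCutVertex, not_not]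
  constructor
  · intro h x hx
    obtain ⟨p⟩ := h.preconnected ⟨x, hx⟩ ⟨t, ht⟩
    obtain ⟨q, hq⟩ := exists_walk_of_induce p
    exact ⟨q, fun hw => (hq w hw).1 rfl⟩
  · intro h
    have key : ∀ x : {y | y ≠ w}, (G.induce {y | y ≠ w}).Reachable x ⟨t, ht⟩ := by
      rintro ⟨x, hx⟩
      obtain ⟨p, hp⟩ := h x hx
      exact ⟨p.induce {y | y ≠ w} fun y hy hyw => hp (hyw ▸ hy)⟩
    exact { preconnected := fun x y => (key x).trans (key y).symm, nonempty := ⟨⟨t, ht⟩⟩ }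

theorem IsCutVertex.exists_separates {G : SimpleGraph V} {c b : V} (hc : IsCutVertex G c)
    (hb : b ≠ c) : ∃ w, w ≠ c ∧ Separates G c b w := by
  by_contra! h
  refine (not_isCutVertex_iff hb).2 (fun x hx => ?_) hc
  obtain ⟨p, hp⟩ := not_forall.1 (h x hx)
  exact ⟨p.reverse, by simpa using hp⟩

theorem Separates.dist_eq_of_adj {G : SimpleGraph V} (hG : G.Connected) {c b w x : V}
    (h : Separates G c b w) (hb : b ≠ c) (hx : x = b ∨ G.Adj b x) :
    G.dist x w = G.dist x c + G.dist c w := by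
  classical
  obtain ⟨p, hp⟩ := hG.exists_walk_length_eq_dist x w
  have hc : c ∈ p.support := by
    obtain rfl | hx := hx
    · exact h p
    · simpa [hb.symm] using h (p.cons hx)
  have h1 := dist_le (p.takeUntil c hc)
  have h2 := dist_le (p.dropUntil c hc)
  have h3 := congrArg Walk.length (p.take_spec hc)
  rw [Walk.length_append] at h3
  have := hG.dist_triangle (u := x) (v := c) (w := w)
  omega

/-- A vertex farthest from `c` among those separated from `b` by `c` can be deleted. -/
theorem Separates.exists_walk_avoiding [Finite V] {G : SimpleGraph V} (hG : G.Connected)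
    {c b d : V} (hd : d ≠ c) (h : Separates G c b d) :
    ∃ w, w ≠ c ∧ Separates G c b w ∧ ∀ x, x ≠ w → ∃ p : G.Walk x c, w ∉ p.support := by
  classical
  obtain ⟨w, ⟨hwc, hw⟩, hmax⟩ := Set.exists_max_image {w | w ≠ c ∧ Separates G c b w}
    (fun w => G.dist w c) (Set.toFinite _) ⟨d, hd, h⟩
  refine ⟨w, hwc, hw, fun x hxw => ?_⟩
  obtain ⟨p, hp, hl⟩ := hG.exists_path_of_dist x c
  refine ⟨p, fun hwp => ?_⟩
  have h1 := hG.pos_dist_of_ne hxw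
  have h2 := dist_le (p.takeUntil w hwp)
  have h3 := dist_le (p.dropUntil w hwp)
  have h4 := congrArg Walk.length (p.take_spec hwp)
  rw [Walk.length_append] at h4
  have hxc : x ≠ c := by
    rintro rfl
    rw [dist_self] at hl
    omega
  have hx : Separates G c b x := by
    intro q
    have := hw (q.append (p.takeUntil w hwp))
    rw [Walk.mem_support_append_iff] at this
    exact this.resolve_right (Walk.endpoint_notMem_support_takeUntil hp hwp hwc.symm)
  have := hmax x ⟨hxc, hx⟩
  omega

theorem exists_adj_of_forall_not_isMaxNeighbor {G : SimpleGraph V} (hG : G.Connected) {v c : V}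
    (hc : c ≠ v) (hv : ∀ y, ¬ IsMaxNeighbor G v y) (w : V) : ∃ u, u ≠ w ∧ G.Adj v u := by
  have : Nontrivial V := ⟨c, v, hc⟩
  obtain ⟨y, hy⟩ := hG.preconnected.exists_adj_of_nontrivial v
  have := hv y
  simp only [IsMaxNeighbor, not_and, not_forall] at this
  obtain ⟨z, hz, hzy, -⟩ := this hy
  obtain rfl | hyw := eq_or_ne y w
  · exact ⟨z, hzy, hz⟩
  · exact ⟨y, hyw, hy⟩

theorem IsCutVertex.exists_separates_not_isCutVertex [Finite V] {G : SimpleGraph V}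
    (hG : G.Connected) {c b : V} (hc : IsCutVertex G c) (hb : b ≠ c) :
    ∃ w, ¬ IsCutVertex G w ∧ Separates G c b w := by
  obtain ⟨d, hd, h⟩ := hc.exists_separates hb
  obtain ⟨w, hwc, hw, hp⟩ := h.exists_walk_avoiding hG hd
  exact ⟨w, (not_isCutVertex_iff hwc.symm).2 hp, hw⟩

theorem IsCutVertex.exists_separates_not_isCutVertex_ne [Finite V] {G : SimpleGraph V}
    (hG : G.Connected) {c b v : V} (hc : IsCutVertex G c) (hb : b ≠ c)
    (hv : ¬ IsCutVertex G v) (hmax : ∀ y, ¬ IsMaxNeighbor G v y) :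
    ∃ w, (¬ IsCutVertex G w ∧ w ≠ v) ∧ Separates G c b w := by
  classical
  obtain ⟨w, hw, hs⟩ := hc.exists_separates_not_isCutVertex hG hb
  obtain rfl | hwv := eq_or_ne w v
  swap
  · exact ⟨w, ⟨hw, hwv⟩, hs⟩
  have hcw : c ≠ w := by rintro rfl; exact hw hc
  have hbw : b ≠ w := by
    rintro rfl
    simpa [hb.symm] using hs Walk.nil
  have hnbr := exists_adj_of_forall_not_isMaxNeighbor hG hcw hmax
  obtain ⟨u, huc, hu⟩ := hnbr c
  have hsu : Separates (G.induce {y | y ≠ w}) ⟨c, hcw⟩ ⟨b, hbw⟩ ⟨u, hu.ne'⟩ := by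
    intro p
    obtain ⟨q, hq⟩ := exists_walk_of_induce p
    have := hs (q.append hu.symm.toWalk)
    rw [Walk.mem_support_append_iff] at this
    exact (hq c (this.resolve_right (by simp [hcw, huc.symm]))).2
  obtain ⟨⟨t, htw⟩, htc, hst, hwalk⟩ :=
    hsu.exists_walk_avoiding (not_not.1 hw) (fun h => huc (congrArg Subtype.val h))
  have htc : t ≠ c := fun h => htc (Subtype.ext h)
  have hwalk' : ∀ x, x ≠ w → x ≠ t → ∃ p : G.Walk x c, t ∉ p.support := by
    intro x hxw hxt
    obtain ⟨p, hp⟩ := hwalk ⟨x, hxw⟩ (fun h => hxt (congrArg Subtype.val h))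
    obtain ⟨q, hq⟩ := exists_walk_of_induce p
    exact ⟨q, fun h => hp (hq t h).2⟩
  refine ⟨t, ⟨(not_isCutVertex_iff htc.symm).2 fun x hxt => ?_, htw⟩, fun p => ?_⟩
  · obtain rfl | hxw := eq_or_ne x w
    · obtain ⟨y, hyt, hy⟩ := hnbr t
      obtain ⟨p, hp⟩ := hwalk' y hy.ne' hyt
      exact ⟨p.cons hy, by simp [hp, hxt.symm]⟩
    · exact hwalk' x hxw hxt
  · by_cases hwp : w ∈ p.support
    · exact p.support_takeUntil_subset_support hwp (hs (p.takeUntil w hwp))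
    · have := hst (p.induce {y | y ≠ w} fun y hy hyw => hwp (hyw ▸ hy))
      rw [Walk.support_induce] at this
      simpa using this

/-- The vertices of a mixed element, as an unordered pair that is diagonal for a vertex. -/
def mixedToSym2 (G : SimpleGraph V) : V ⊕ G.edgeSet → Sym2 V
  | Sum.inl v => s(v, v)
  | Sum.inr e => e

theorem mixedDist_eq (G : SimpleGraph V) (w : V) (x : V ⊕ G.edgeSet) :
    mixedDist G w x = edgeVertexDist G w (mixedToSym2 G x) := by
  cases x <;> simp [mixedDist, mixedToSym2, edgeVertexDist]

theorem mixedToSym2_injective (G : SimpleGraph V) : Function.Injective (mixedToSym2 G) := by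
  rintro (a | ⟨e, he⟩) (b | ⟨f, hf⟩) h
  · simpa [mixedToSym2] using h
  · exact absurd ((show s(a, a) = f from h) ▸ hf) (by simp)
  · exact absurd ((show e = s(b, b) from h) ▸ he) (by simp)
  · simpa [mixedToSym2] using h

theorem exists_mixedToSym2_eq (G : SimpleGraph V) (x : V ⊕ G.edgeSet) :
    ∃ a b, (b = a ∨ G.Adj a b) ∧ mixedToSym2 G x = s(a, b) := by
  obtain a | ⟨e, he⟩ := x
  · exact ⟨a, a, .inl rfl, rfl⟩
  · induction e with | _ a b => exact ⟨a, b, .inr he, rfl⟩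

theorem edgeVertexDist_mk (G : SimpleGraph V) (w a b : V) :
    edgeVertexDist G w s(a, b) = min (G.dist a w) (G.dist b w) := rfl

/-- Some vertex of `W` is only accessible from the closed neighborhood of `b` through `c`. -/
def HasGate (G : SimpleGraph V) (W : Set V) (c b : V) : Prop :=
  ∃ w ∈ W, ∀ x, x = b ∨ G.Adj b x → G.dist x w = G.dist x c + G.dist c w

theorem hasGate_of_mem {G : SimpleGraph V} {W : Set V} {c : V} (hc : c ∈ W) (b : V) :
    HasGate G W c b :=
  ⟨c, hc, by simp⟩

theorem exists_mixedDist_ne_of_mem {G : SimpleGraph V} (hG : G.Connected) {W : Set V} {c : V}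
    (hgate : ∀ b, b ≠ c → HasGate G W c b) {x y : V ⊕ G.edgeSet} (hx : c ∈ mixedToSym2 G x)
    (hy : c ∉ mixedToSym2 G y) : ∃ w ∈ W, mixedDist G w x ≠ mixedDist G w y := by
  obtain ⟨a, b, hab, hab'⟩ := exists_mixedToSym2_eq G y
  obtain ⟨d, hd⟩ := hx
  rw [hab', Sym2.mem_iff, not_or] at hy
  obtain ⟨w, hw, h⟩ := hgate a (Ne.symm hy.1)
  refine ⟨w, hw, ?_⟩
  rw [mixedDist_eq, mixedDist_eq, hab', hd, edgeVertexDist_mk, edgeVertexDist_mk, h a (.inl rfl),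
    h b hab]
  have := hG.pos_dist_of_ne (Ne.symm hy.1)
  have := hG.pos_dist_of_ne (Ne.symm hy.2)
  omega

theorem exists_mixedDist_ne_of_forall_not_isMaxNeighbor {G : SimpleGraph V} (hG : G.Connected)
    {W : Set V} {v : V} (hmax : ∀ y, ¬ IsMaxNeighbor G v y)
    (hgate : ∀ c, c ≠ v → ∀ b, b ≠ c → HasGate G W c b) {x y : V ⊕ G.edgeSet}
    (hx : v ∈ mixedToSym2 G x) (hy : v ∉ mixedToSym2 G y) :
    ∃ w ∈ W, mixedDist G w x ≠ mixedDist G w y := by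
  by_cases hyx : ∃ c, c ∈ mixedToSym2 G y ∧ c ∉ mixedToSym2 G x
  · obtain ⟨c, hcy, hcx⟩ := hyx
    have hcv : c ≠ v := by rintro rfl; exact hy hcy
    obtain ⟨w, hw, h⟩ := exists_mixedDist_ne_of_mem hG (hgate c hcv) hcy hcx
    exact ⟨w, hw, h.symm⟩
  push Not at hyx
  obtain ⟨a, b, -, hab⟩ := exists_mixedToSym2_eq G y
  rw [hab] at hyx hy
  rw [Sym2.mem_iff, not_or] at hy
  have hxa : mixedToSym2 G x = s(v, a) :=
    (Sym2.mem_and_mem_iff hy.1).1 ⟨hx, hyx a (Sym2.mem_mk_left a b)⟩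
  have hba : b = a := by
    have := hyx b (Sym2.mem_mk_right a b)
    rw [hxa, Sym2.mem_iff] at this
    exact this.resolve_left (Ne.symm hy.2)
  subst hba
  have hva : G.Adj v b := by
    obtain u | ⟨e, he⟩ := x
    · have := hxa
      simp only [mixedToSym2, Sym2.eq_iff] at this
      exact absurd (by grind : v = b) hy.1
    · rwa [show e = s(v, b) from hxa, mem_edgeSet] at he
  have := hmax b
  simp only [IsMaxNeighbor, not_and, not_forall] at this
  obtain ⟨z, hz, hzb, hbz⟩ := this hva
  obtain ⟨w, hw, h⟩ := hgate z hz.ne' v hz.ne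
  refine ⟨w, hw, ?_⟩
  rw [mixedDist_eq, mixedDist_eq, hab, hxa, edgeVertexDist_mk, edgeVertexDist_mk, h v (.inl rfl),
    h b (.inr hva), dist_eq_one_iff_adj.2 hz]
  have := hG.one_lt_dist_of_ne_of_not_adj hzb.symm hbz
  omega

theorem isMixedResolving_of_mem {G : SimpleGraph V} {W : Set V}
    (h : ∀ c x y, c ∈ mixedToSym2 G x → c ∉ mixedToSym2 G y →
      ∃ w ∈ W, mixedDist G w x ≠ mixedDist G w y) : IsMixedResolving G W := by
  intro x y hxy
  have : ¬ ∀ c, c ∈ mixedToSym2 G x ↔ c ∈ mixedToSym2 G y :=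
    fun h => hxy (mixedToSym2_injective G (Sym2.ext h))
  simp only [not_forall, not_iff] at this
  obtain ⟨c, hc⟩ := this
  by_cases hx : c ∈ mixedToSym2 G x
  · exact h c x y hx (by tauto)
  · obtain ⟨w, hw, h⟩ := h c y x (hc.1 hx) hx
    exact ⟨w, hw, h.symm⟩

theorem isMixedResolving_compl_isCutVertex [Finite V] {G : SimpleGraph V} (hG : G.Connected) :
    IsMixedResolving G {w | ¬ IsCutVertex G w} := by
  refine isMixedResolving_of_mem fun c x y => exists_mixedDist_ne_of_mem hG fun b hb => ?_
  by_cases hc : IsCutVertex G c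
  · obtain ⟨w, hw, hs⟩ := hc.exists_separates_not_isCutVertex hG hb
    exact ⟨w, hw, fun x hx => hs.dist_eq_of_adj hG hb hx⟩
  · exact hasGate_of_mem hc b

theorem isMixedResolving_compl_isCutVertex_sdiff_singleton [Finite V] {G : SimpleGraph V}
    (hG : G.Connected) {v : V} (hv : ¬ IsCutVertex G v) (hmax : ∀ y, ¬ IsMaxNeighbor G v y) :
    IsMixedResolving G {w | ¬ IsCutVertex G w ∧ w ≠ v} := by
  have hgate : ∀ c, c ≠ v → ∀ b, b ≠ c → HasGate G {w | ¬ IsCutVertex G w ∧ w ≠ v} c b := by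
    intro c hcv b hb
    by_cases hc : IsCutVertex G c
    · obtain ⟨w, hw, hs⟩ := hc.exists_separates_not_isCutVertex_ne hG hb hv hmax
      exact ⟨w, hw, fun x hx => hs.dist_eq_of_adj hG hb hx⟩
    · exact hasGate_of_mem (W := {w | ¬ IsCutVertex G w ∧ w ≠ v}) ⟨hc, hcv⟩ b
  refine isMixedResolving_of_mem fun c x y => ?_
  obtain rfl | hcv := eq_or_ne c v
  · exact exists_mixedDist_ne_of_forall_not_isMaxNeighbor hG hmax hgate
  · exact exists_mixedDist_ne_of_mem hG (hgate c hcv)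

/-- A vertex with a maximal neighbor lies in every mixed resolving set. -/
theorem IsMaxNeighbor.mem_of_isMixedResolving {G : SimpleGraph V} (hG : G.Connected) {v y : V}
    (h : IsMaxNeighbor G v y) {W : Set V} (hW : IsMixedResolving G W) : v ∈ W := by
  obtain ⟨w, hw, hne⟩ := hW (Sum.inr ⟨s(v, y), h.1⟩) (Sum.inl y) (by simp)
  suffices w = v from this ▸ hw
  by_contra hwv
  refine hne ?_
  change min (G.dist v w) (G.dist y w) = G.dist y w
  refine min_eq_right ?_
  obtain ⟨p, hp⟩ := hG.exists_walk_length_eq_dist v w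
  cases p with
  | nil => exact absurd rfl hwv
  | @cons _ z _ hz q =>
    rw [← hp, Walk.length_cons]
    obtain rfl | hzy := eq_or_ne z y
    · exact (dist_le q).trans (Nat.le_succ _)
    · exact dist_le (q.cons (h.2 z hz hzy))

theorem mdim_le_ncard [Fintype V] {G : SimpleGraph V} {W : Set V} (hW : IsMixedResolving G W) :
    mdim G ≤ W.ncard :=
  Nat.sInf_le ⟨(Set.toFinite W).toFinset, (Set.ncard_eq_toFinset_card W).symm, by simpa using hW⟩

/-- For a connected graph `G`, `mdim G = |V(G)| - ζ(G)` iff every non-cut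
vertex of `G` has a maximal neighbor. -/
theorem stmt_13 [Fintype V] (G : SimpleGraph V) (hG : G.Connected) :
    mdim G = Fintype.card V - {v : V | IsCutVertex G v}.ncard ↔
      ∀ v : V, ¬ IsCutVertex G v → ∃ y : V, IsMaxNeighbor G v y := by
  have hcard : {v | ¬ IsCutVertex G v}.ncard = Fintype.card V - {v | IsCutVertex G v}.ncard := by
    rw [← Nat.card_eq_fintype_card, ← Set.ncard_compl, Set.compl_ofPred]
  rw [← hcard]
  constructor
  · intro h v hv
    by_contra! hmax
    refine (mdim_le_ncard
      (isMixedResolving_compl_isCutVertex_sdiff_singleton hG hv hmax)).not_gt ?_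
    rw [h]
    exact Set.ncard_lt_ncard ⟨fun w hw => hw.1, fun hsub => (hsub hv).2 rfl⟩
  · intro h
    have hN := isMixedResolving_compl_isCutVertex hG
    refine le_antisymm (mdim_le_ncard hN) (le_csInf ⟨_, (Set.toFinite _).toFinset, rfl,
      by simpa using hN⟩ ?_)
    rintro _ ⟨W, rfl, hW⟩
    rw [← Set.ncard_coe_finset]
    refine Set.ncard_le_ncard fun v hv => ?_
    obtain ⟨y, hy⟩ := h v hv
    exact hy.mem_of_isMixedResolving hG hW
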